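/- arXiv:1403.0909 — 2 statements merged into one kernel-verified Lean document; each statement's English description precedes it below -/
import Mathlib

section
/- Let Γ be a countable group and S a finite nonempty multiset in Γ. Define the conductance constant h(Γ,S) = (1/|S|)·inf over finite nonempty F ⊆ Γ of (Σ_{s∈S}|sF \ F|)/|F|. Then Γ is non-amenable if and only if for every ε ∈ (0,1) there exists a finite multiset S with h(Γ,S) > 1 − ε. -/
open BoundedContinuousFunction

/-- The left-regular lregTranslate of a bounded function: `(γ · f)(x) = f(γ⁻¹ • x)`. -/
noncomputable def lregTranslate {Γ X : Type*} [Group Γ] [MulAction Γ X]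
    [TopologicalSpace X] [DiscreteTopology X] (γ : Γ) (f : X →ᵇ ℝ) : X →ᵇ ℝ :=
  f.compContinuous ⟨fun x => γ⁻¹ • x, continuous_of_discreteTopology⟩

/-- A `Γ`-invariant mean on `ℓ∞(X)`: a positive linear functional with `m 1 = 1`
invariant under the left-regular action. -/
structure InvariantMean (Γ X : Type*) [Group Γ] [MulAction Γ X]
    [TopologicalSpace X] [DiscreteTopology X] where
  toFun : (X →ᵇ ℝ) →ₗ[ℝ] ℝ
  nonneg : ∀ f : X →ᵇ ℝ, (∀ x, 0 ≤ f x) → 0 ≤ toFun f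
  map_one : toFun 1 = 1
  invariant : ∀ (γ : Γ) (f : X →ᵇ ℝ), toFun (lregTranslate γ f) = toFun f


/-- The conductance (isoperimetric) constant
`h(Γ,S) = (1/|S|) · inf_{F finite nonempty} (Σ_{s∈S} |sF \ F|) / |F|`
for a finite multiset `S = (s₁, …, sₙ)` in `Γ`. -/
noncomputable def conductance {Γ : Type*} [Group Γ] [DecidableEq Γ]
    (n : ℕ) (S : Fin n → Γ) : ℝ :=
  (1 / (n : ℝ)) * ⨅ F : {F : Finset Γ // F.Nonempty},
    (∑ i, (((F : Finset Γ).image (S i • ·) \ (F : Finset Γ)).card : ℝ)) / ((F : Finset Γ).card : ℝ)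

/-- The indicator function of a set, as a bounded function on a discrete space. -/
noncomputable def boundedIndicator {X : Type*} [TopologicalSpace X] [DiscreteTopology X]
    (A : Set X) : X →ᵇ ℝ :=
  BoundedContinuousFunction.ofNormedAddCommGroupDiscrete (A.indicator 1) 1 fun x => by
    by_cases hx : x ∈ A <;> simp [hx]

open Classical in
lemma boundedIndicator_apply {X : Type*} [TopologicalSpace X] [DiscreteTopology X]
    (A : Set X) (x : X) : boundedIndicator A x = if x ∈ A then 1 else 0 := by
  simp [boundedIndicator, Set.indicator_apply]

lemma InvariantMean.mono {Γ X : Type*} [Group Γ] [MulAction Γ X]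
    [TopologicalSpace X] [DiscreteTopology X] (m : InvariantMean Γ X) {f g : X →ᵇ ℝ}
    (h : ∀ x, f x ≤ g x) : m.toFun f ≤ m.toFun g := by
  have := m.nonneg (g - f) fun x => by simpa using h x
  rw [map_sub] at this
  linarith

open scoped Pointwise

/-- A group carrying an injection `Γ × Bool → Γ` with bounded displacement is paradoxical, hence
has no invariant mean. -/
lemma isEmpty_invariantMean_of_injective {Γ : Type*} [Group Γ]
    [TopologicalSpace Γ] [DiscreteTopology Γ] (K : Finset Γ) (φ : Γ × Bool → Γ)
    (hφ : Function.Injective φ) (hK : ∀ p, φ p * p.1⁻¹ ∈ K) :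
    IsEmpty (InvariantMean Γ Γ) := by
  classical
  refine ⟨fun m => ?_⟩
  let A : Bool → Γ → Set Γ := fun b t => {x | φ (x, b) = t * x}
  have hone (b : Bool) : ∑ t ∈ K, boundedIndicator (A b t) = 1 := by
    ext x
    have hmem : φ (x, b) * x⁻¹ ∈ K := hK (x, b)
    have : ∀ t ∈ K, boundedIndicator (A b t) x = if φ (x, b) * x⁻¹ = t then 1 else 0 := by
      intro t _
      simp [boundedIndicator_apply, A, mul_inv_eq_iff_eq_mul]
    simp only [BoundedContinuousFunction.coe_sum, Finset.sum_apply,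
      BoundedContinuousFunction.coe_one, Pi.one_apply]
    rw [Finset.sum_congr rfl this]
    simp [hmem]
  have hle : ∀ y, (∑ q ∈ (Finset.univ : Finset Bool) ×ˢ K,
      lregTranslate q.2 (boundedIndicator (A q.1 q.2))) y ≤ (1 : Γ →ᵇ ℝ) y := by
    intro y
    have : ∀ q ∈ (Finset.univ : Finset Bool) ×ˢ K,
        lregTranslate q.2 (boundedIndicator (A q.1 q.2)) y =
          if φ (q.2⁻¹ * y, q.1) = y then 1 else 0 := by
      intro q _
      simp [lregTranslate, boundedIndicator_apply, A]
    simp only [BoundedContinuousFunction.coe_sum, Finset.sum_apply,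
      BoundedContinuousFunction.coe_one, Pi.one_apply]
    rw [Finset.sum_congr rfl this, Finset.sum_boole]
    have hcard : (((Finset.univ : Finset Bool) ×ˢ K).filter
        fun q => φ (q.2⁻¹ * y, q.1) = y).card ≤ 1 := by
      refine Finset.card_le_one.2 fun q hq r hr => ?_
      have h := hφ ((Finset.mem_filter.1 hq).2.trans (Finset.mem_filter.1 hr).2.symm)
      simp only [Prod.mk.injEq, mul_left_inj, inv_inj] at h
      exact Prod.ext h.2 h.1
    exact_mod_cast hcard
  have h := m.mono hle
  have hb (b : Bool) : ∑ t ∈ K, m.toFun (boundedIndicator (A b t)) = 1 := by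
    rw [← map_sum, hone, m.map_one]
  rw [map_sum, m.map_one, Finset.sum_product] at h
  simp only [m.invariant, hb] at h
  norm_num at h

/-- If every finite set is at least doubled by `K`, then Hall's theorem yields a paradoxical
decomposition. -/
lemma isEmpty_invariantMean_of_doubling {Γ : Type*} [Group Γ] [DecidableEq Γ]
    [TopologicalSpace Γ] [DiscreteTopology Γ] (K : Finset Γ)
    (hK : ∀ F : Finset Γ, 2 * F.card ≤ (K * F).card) :
    IsEmpty (InvariantMean Γ Γ) := by
  have hall := (Finset.all_card_le_biUnion_card_iff_exists_injective
    (fun p : Γ × Bool => K.image (· * p.1))).1 fun A => by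
      have h1 : A.card ≤ (A.image Prod.fst ×ˢ (Finset.univ : Finset Bool)).card :=
        Finset.card_le_card fun p hp => by
          exact Finset.mem_product.2 ⟨Finset.mem_image_of_mem _ hp, Finset.mem_univ _⟩
      have h2 : A.biUnion (fun p : Γ × Bool => K.image (· * p.1)) = K * A.image Prod.fst := by
        ext y
        simp only [Finset.mem_biUnion, Finset.mem_image, Finset.mem_mul]
        constructor
        · rintro ⟨p, hp, t, ht, rfl⟩
          exact ⟨t, ht, p.1, ⟨p, hp, rfl⟩, rfl⟩
        · rintro ⟨t, ht, _, ⟨p, hp, rfl⟩, rfl⟩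
          exact ⟨p, hp, t, ht, rfl⟩
      rw [h2]
      have h3 := hK (A.image Prod.fst)
      rw [Finset.card_product] at h1
      simp at h1
      omega
  obtain ⟨φ, hφ, hmem⟩ := hall
  refine isEmpty_invariantMean_of_injective K φ hφ fun p => ?_
  obtain ⟨t, ht, h⟩ := Finset.mem_image.1 (hmem p)
  simpa [← h] using ht

lemma bddBelow_conductance_ratio {Γ : Type*} [Group Γ] [DecidableEq Γ]
    (n : ℕ) (S : Fin n → Γ) :
    BddBelow (Set.range fun F : {F : Finset Γ // F.Nonempty} =>
      (∑ i, (((F : Finset Γ).image (S i • ·) \ (F : Finset Γ)).card : ℝ)) /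
        ((F : Finset Γ).card : ℝ)) :=
  ⟨0, by rintro _ ⟨F, rfl⟩; positivity⟩

lemma isEmpty_invariantMean_of_conductance {Γ : Type*} [Group Γ] [DecidableEq Γ]
    [TopologicalSpace Γ] [DiscreteTopology Γ] {n : ℕ} (S : Fin n → Γ) (hn : 0 < n)
    (hS : 1 / 2 < conductance n S) : IsEmpty (InvariantMean Γ Γ) := by
  let T : Finset Γ := insert 1 (Finset.univ.image S)
  have hT : ∀ F : Finset Γ, 3 * F.card ≤ 2 * (T * F).card := by
    intro F
    rcases F.eq_empty_or_nonempty with rfl | hF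
    · simp
    have hF0 : (0 : ℝ) < F.card := by exact_mod_cast hF.card_pos
    have hn0 : (0 : ℝ) < n := by exact_mod_cast hn
    have hinf := ciInf_le (bddBelow_conductance_ratio n S) ⟨F, hF⟩
    have hlt : (n : ℝ) * (F.card / 2) < ∑ i, ((F.image (S i • ·) \ F).card : ℝ) := by
      rw [conductance, one_div_mul_eq_div, lt_div_iff₀ hn0] at hS
      have := hS.trans_le hinf
      rw [lt_div_iff₀ hF0] at this
      linarith
    obtain ⟨i, hi⟩ : ∃ i, (F.card : ℝ) / 2 < (F.image (S i • ·) \ F).card := by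
      by_contra! h
      have := Finset.sum_le_sum fun i (_ : i ∈ Finset.univ) => h i
      simp only [Finset.sum_const, Finset.card_univ, Fintype.card_fin, nsmul_eq_mul] at this
      linarith
    have hsub : F ∪ (F.image (S i • ·) \ F) ⊆ T * F := by
      intro x hx
      rw [Finset.mem_union, Finset.mem_sdiff, Finset.mem_image] at hx
      rcases hx with hx | ⟨⟨y, hy, rfl⟩, _⟩
      · exact Finset.mem_mul.2 ⟨1, by simp [T], x, hx, one_mul x⟩
      · exact Finset.mem_mul.2 ⟨S i, by simp [T], y, hy, rfl⟩
    have hcard := Finset.card_le_card hsub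
    rw [Finset.card_union_of_disjoint Finset.disjoint_sdiff] at hcard
    have hi' : F.card < 2 * (F.image (S i • ·) \ F).card := by
      have : (F.card : ℝ) < 2 * (F.image (S i • ·) \ F).card := by linarith
      exact_mod_cast this
    omega
  refine isEmpty_invariantMean_of_doubling (T * T) fun F => ?_
  have h1 := hT F
  have h2 := hT (T * F)
  rw [mul_assoc]
  omega

/-- A limit of asymptotically invariant means is an invariant mean. -/
lemma nonempty_invariantMean_of_approx {Γ : Type*} [Group Γ]
    [TopologicalSpace Γ] [DiscreteTopology Γ]
    (h : ∀ (T : Finset Γ) (η : ℝ), 0 < η → ∃ m : (Γ →ᵇ ℝ) →ₗ[ℝ] ℝ,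
      (∀ f : Γ →ᵇ ℝ, (∀ x, 0 ≤ f x) → 0 ≤ m f) ∧ m 1 = 1 ∧
      ∀ s ∈ T, ∀ f : Γ →ᵇ ℝ, |m (lregTranslate s f) - m f| ≤ η * ‖f‖) :
    Nonempty (InvariantMean Γ Γ) := by
  classical
  choose m hnn hone hinv using fun i : Finset Γ × ℕ =>
    h i.1 (1 / ((i.2 : ℝ) + 1)) Nat.one_div_pos_of_nat
  let U : Ultrafilter (Finset Γ × ℕ) := Ultrafilter.of Filter.atTop
  have hU : (U : Filter (Finset Γ × ℕ)) ≤ Filter.atTop := Ultrafilter.of_le _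
  have hmono (i) {f g : Γ →ᵇ ℝ} (hfg : ∀ x, f x ≤ g x) : m i f ≤ m i g := by
    have := hnn i (g - f) fun x => by simpa using hfg x
    rw [map_sub] at this
    linarith
  have hbound (i) (f : Γ →ᵇ ℝ) : m i f ∈ Set.Icc (-‖f‖) ‖f‖ := by
    have hc (c : ℝ) : m i (c • 1) = c := by rw [map_smul, hone]; simp
    constructor
    · rw [← hc (-‖f‖)]
      exact hmono i fun x => by simpa using (abs_le.1 (f.norm_coe_le_norm x)).1
    · rw [← hc ‖f‖]
      exact hmono i fun x => by simpa using (abs_le.1 (f.norm_coe_le_norm x)).2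
  have hlim (f : Γ →ᵇ ℝ) : ∃ L, Filter.Tendsto (fun i => m i f) U (nhds L) := by
    obtain ⟨L, -, hL⟩ := (isCompact_Icc (a := -‖f‖) (b := ‖f‖)).ultrafilter_le_nhds
      (U.map fun i => m i f) (by
        rw [Filter.le_principal_iff]
        exact Filter.mem_map.2 (Filter.Eventually.of_forall fun i => hbound i f))
    exact ⟨L, hL⟩
  choose L hL using hlim
  refine ⟨⟨⟨⟨L, fun f g => ?_⟩, fun c f => ?_⟩, fun f hf => ?_, ?_, fun s f => ?_⟩⟩
  · refine tendsto_nhds_unique (hL (f + g)) ?_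
    simpa only [map_add] using (hL f).add (hL g)
  · refine tendsto_nhds_unique (hL (c • f)) ?_
    simpa only [map_smul, RingHom.id_apply] using (hL f).const_smul c
  · exact ge_of_tendsto' (hL f) fun i => hnn i f hf
  · refine tendsto_nhds_unique (hL 1) ?_
    simp only [hone]
    exact tendsto_const_nhds
  · have hsub := (hL (lregTranslate s f)).sub (hL f)
    have hfst : ∀ᶠ i : Finset Γ × ℕ in U, s ∈ i.1 := by
      refine hU ?_
      filter_upwards [Filter.eventually_ge_atTop (({s} : Finset Γ), 0)] with i hi
      exact hi.1 (Finset.mem_singleton_self s)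
    have hz : Filter.Tendsto (fun i : Finset Γ × ℕ => 1 / ((i.2 : ℝ) + 1) * ‖f‖) U (nhds 0) := by
      have h1 : Filter.Tendsto (fun i : Finset Γ × ℕ => i.2) U Filter.atTop := by
        have : Filter.Tendsto (fun i : Finset Γ × ℕ => i.2) Filter.atTop Filter.atTop := by
          rw [← Filter.prod_atTop_atTop_eq]
          exact Filter.tendsto_snd
        exact this.mono_left hU
      simpa using (tendsto_one_div_add_atTop_nhds_zero_nat.comp h1).mul_const ‖f‖
    have h0 := squeeze_zero_norm'
      (f := fun i => m i (lregTranslate s f) - m i f) (hfst.mono fun i hi => hinv i s hi f) hz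
    exact sub_eq_zero.1 (tendsto_nhds_unique hsub h0)

/-- A power of a sum of group elements in a representation is a sum over words. -/
lemma exists_sum_pow_eq {Γ A : Type*} [Group Γ] [Semiring A]
    (π : Γ →* A) {m : ℕ} (S : Fin m → Γ) (n : ℕ) :
    ∃ (κ : Type) (_ : Fintype κ) (w : κ → Γ), Fintype.card κ = m ^ n ∧
      (∑ i, π (S i)) ^ n = ∑ k, π (w k) := by
  induction n with
  | zero => exact ⟨Unit, inferInstance, 1, by simp, by simp⟩
  | succ n ih =>
    obtain ⟨κ, _, w, hcard, hw⟩ := ih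
    refine ⟨κ × Fin m, inferInstance, fun p => w p.1 * S p.2, ?_, ?_⟩
    · simp [hcard, pow_succ]
    · rw [pow_succ, hw, Finset.sum_mul_sum, Fintype.sum_prod_type]
      simp

/-- If matrix coefficients of averages over arbitrary multisets do not decay, then no average
over a multiset has a spectral gap. -/
lemma exists_almost_norm_preserved {Γ H : Type*} [Group Γ] [NormedAddCommGroup H]
    [InnerProductSpace ℝ H] (π : Γ →* Module.End ℝ H) (hπ : ∀ g x, ‖π g x‖ = ‖x‖) {k : ℝ}
    (hk : 0 < k)
    (hv : ∀ (κ : Type) [Fintype κ] [Nonempty κ] (w : κ → Γ), ∃ v : H, v ≠ 0 ∧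
      k * Fintype.card κ * ‖v‖ ^ 2 ≤ ∑ i, inner ℝ (π (w i) v) v)
    {m : ℕ} (hm : 0 < m) (S : Fin m → Γ) {c : ℝ} (hc : 0 < c) (hc1 : c < 1) :
    ∃ g : H, c * m ^ 2 * ‖g‖ ^ 2 < ‖∑ i, π (S i) g‖ ^ 2 := by
  by_contra! h
  set P : Module.End ℝ H := ∑ i, π (S i) with hP
  have hPn (n : ℕ) (v : H) : ‖(P ^ n) v‖ ^ 2 ≤ (c * m ^ 2) ^ n * ‖v‖ ^ 2 := by
    induction n with
    | zero => simp
    | succ n ih =>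
      rw [pow_succ' P, Module.End.mul_apply]
      calc ‖P ((P ^ n) v)‖ ^ 2 ≤ c * m ^ 2 * ‖(P ^ n) v‖ ^ 2 := by
            simpa [hP, LinearMap.sum_apply] using h ((P ^ n) v)
        _ ≤ c * m ^ 2 * ((c * m ^ 2) ^ n * ‖v‖ ^ 2) := by gcongr
        _ = _ := by ring
  obtain ⟨n, hn⟩ := exists_pow_lt_of_lt_one hk hc1
  obtain ⟨κ, _, w, hcard, hw⟩ := exists_sum_pow_eq π S n
  have : Nonempty κ := Fintype.card_pos_iff.1 (hcard ▸ pow_pos hm n)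
  obtain ⟨v, hv0, hv⟩ := hv (κ × κ) fun p => (w p.1)⁻¹ * w p.2
  have hinner (g : Γ) (x y : H) : inner ℝ (π g x) (π g y) = inner ℝ x y :=
    (LinearMap.norm_map_iff_inner_map_map (π g)).1 (hπ g) x y
  have hsum : ∑ p : κ × κ, inner ℝ (π ((w p.1)⁻¹ * w p.2) v) v = ‖(P ^ n) v‖ ^ 2 := by
    rw [hw, ← real_inner_self_eq_norm_sq, LinearMap.sum_apply, sum_inner,
      Fintype.sum_prod_type, Finset.sum_comm]
    refine Finset.sum_congr rfl fun a _ => ?_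
    rw [inner_sum]
    refine Finset.sum_congr rfl fun b _ => ?_
    rw [← hinner (w b), map_mul, ← Module.End.mul_apply, ← mul_assoc, ← map_mul]
    simp
  have hupper := hPn n v
  rw [hsum] at hv
  have hv2 : 0 < ‖v‖ ^ 2 := by positivity
  have hmn : (0 : ℝ) < ((m : ℝ) ^ n) ^ 2 := by positivity
  have hle := hv.trans hupper
  rw [Fintype.card_prod, hcard, mul_pow] at hle
  push_cast at hle
  have := le_of_mul_le_mul_right hle hv2
  have h' : k * ((m : ℝ) ^ n) ^ 2 ≤ c ^ n * ((m : ℝ) ^ n) ^ 2 := by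
    calc _ = k * ((m : ℝ) ^ n * (m : ℝ) ^ n) := by ring
      _ ≤ _ := this
      _ = _ := by ring
  exact absurd (le_of_mul_le_mul_right h' hmn) (not_le.2 hn)

lemma norm_sub_sq_le_of_norm_eq {H : Type*} [NormedAddCommGroup H] [InnerProductSpace ℝ H]
    {m : ℕ} (u : Fin m → H) {r : ℝ} (hu : ∀ i, ‖u i‖ = r) (i j : Fin m) :
    ‖u i - u j‖ ^ 2 ≤ 2 * m ^ 2 * r ^ 2 - 2 * ‖∑ i, u i‖ ^ 2 := by
  calc ‖u i - u j‖ ^ 2 ≤ ∑ j, ‖u i - u j‖ ^ 2 :=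
        Finset.single_le_sum (f := fun j => ‖u i - u j‖ ^ 2) (fun _ _ => sq_nonneg _)
          (Finset.mem_univ j)
    _ ≤ ∑ i, ∑ j, ‖u i - u j‖ ^ 2 :=
        Finset.single_le_sum (f := fun i => ∑ j, ‖u i - u j‖ ^ 2)
          (fun _ _ => Finset.sum_nonneg fun _ _ => sq_nonneg _) (Finset.mem_univ i)
    _ = 2 * m ^ 2 * r ^ 2 - 2 * ‖∑ i, u i‖ ^ 2 := by
        rw [← real_inner_self_eq_norm_sq (∑ i, u i), sum_inner]
        simp only [inner_sum, norm_sub_sq_real, hu, Finset.sum_add_distrib,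
          Finset.sum_sub_distrib, ← Finset.mul_sum, Finset.sum_const, Finset.card_univ,
          Fintype.card_fin, nsmul_eq_mul]
        ring

lemma summable_sq_lp {X : Type*} (f : lp (fun _ : X => ℝ) 2) : Summable fun x => f x ^ 2 := by
  simpa [pow_two] using lp.summable_inner (𝕜 := ℝ) f f

lemma norm_sq_eq_tsum_lp {X : Type*} (f : lp (fun _ : X => ℝ) 2) :
    ‖f‖ ^ 2 = ∑' x, f x ^ 2 := by
  rw [← real_inner_self_eq_norm_sq, lp.inner_eq_tsum]
  simp [pow_two]

lemma memℓp_two_of_summable_sq {X : Type*} {f : X → ℝ} (h : Summable fun x => f x ^ 2) :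
    Memℓp f 2 :=
  memℓp_gen (by simpa using h)

/-- The left-regular representation of `Γ` on `ℓ²(Γ)`. -/
noncomputable def leftRegular (Γ : Type*) [Group Γ] :
    Γ →* Module.End ℝ (lp (fun _ : Γ => ℝ) 2) where
  toFun s :=
    { toFun := fun f => ⟨fun x => f (s⁻¹ * x), memℓp_two_of_summable_sq
        ((Equiv.mulLeft s⁻¹).summable_iff.2 (summable_sq_lp f))⟩
      map_add' := fun _ _ => rfl
      map_smul' := fun _ _ => rfl }
  map_one' := by
    ext f x
    simp
  map_mul' s t := by
    ext f x
    change f ((s * t)⁻¹ * x) = f (t⁻¹ * (s⁻¹ * x))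
    rw [mul_inv_rev, mul_assoc]

@[simp]
lemma leftRegular_apply {Γ : Type*} [Group Γ] (s : Γ) (f : lp (fun _ : Γ => ℝ) 2) (x : Γ) :
    leftRegular Γ s f x = f (s⁻¹ * x) :=
  rfl

lemma norm_leftRegular {Γ : Type*} [Group Γ] (s : Γ) (f : lp (fun _ : Γ => ℝ) 2) :
    ‖leftRegular Γ s f‖ = ‖f‖ := by
  rw [← sq_eq_sq₀ (norm_nonneg _) (norm_nonneg _), norm_sq_eq_tsum_lp, norm_sq_eq_tsum_lp]
  exact (Equiv.mulLeft s⁻¹).tsum_eq fun x => f x ^ 2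

/-- The indicator function of a finite set, as an element of `ℓ²`. -/
noncomputable def finsetIndicator {X : Type*} [DecidableEq X] (F : Finset X) :
    lp (fun _ : X => ℝ) 2 :=
  ⟨fun x => if x ∈ F then 1 else 0, memℓp_two_of_summable_sq
    (summable_of_ne_finset_zero (s := F) fun x hx => by simp [hx])⟩

lemma finsetIndicator_apply {X : Type*} [DecidableEq X] (F : Finset X) (x : X) :
    finsetIndicator F x = if x ∈ F then 1 else 0 :=
  rfl

lemma norm_finsetIndicator_sq {X : Type*} [DecidableEq X] (F : Finset X) :
    ‖finsetIndicator F‖ ^ 2 = F.card := by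
  rw [norm_sq_eq_tsum_lp, tsum_eq_sum (s := F) fun x hx => by simp [finsetIndicator_apply, hx]]
  rw [Finset.sum_congr rfl fun x hx => by rw [finsetIndicator_apply, if_pos hx, one_pow]]
  simp

lemma inner_leftRegular_finsetIndicator {Γ : Type*} [Group Γ] [DecidableEq Γ] (s : Γ)
    (F : Finset Γ) :
    inner ℝ (leftRegular Γ s (finsetIndicator F)) (finsetIndicator F) =
      ((F.image (s • ·) ∩ F).card : ℝ) := by
  have hmem (x : Γ) : s⁻¹ * x ∈ F ↔ x ∈ F.image (s • ·) := by
    simp only [Finset.mem_image, smul_eq_mul]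
    exact ⟨fun h => ⟨_, h, by simp⟩, by rintro ⟨y, hy, rfl⟩; simpa using hy⟩
  have hterm (x : Γ) : inner ℝ (leftRegular Γ s (finsetIndicator F) x) (finsetIndicator F x) =
      if x ∈ F.image (s • ·) ∩ F then (1 : ℝ) else 0 := by
    simp only [leftRegular_apply, finsetIndicator_apply, Finset.mem_inter, hmem]
    by_cases h1 : x ∈ F.image (s • ·) <;> by_cases h2 : x ∈ F <;> simp only [h1, h2] <;> simp
  rw [lp.inner_eq_tsum, tsum_congr hterm,
    tsum_eq_sum (s := F.image (s • ·) ∩ F) fun x hx => if_neg hx,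
    Finset.sum_congr rfl fun x hx => if_pos hx]
  simp

lemma summable_mul_sq_lp {X : Type*} [TopologicalSpace X] (φ : X →ᵇ ℝ)
    (g : lp (fun _ : X => ℝ) 2) : Summable fun x => φ x * g x ^ 2 := by
  refine Summable.of_norm_bounded ((summable_sq_lp g).mul_left ‖φ‖) fun x => ?_
  rw [norm_mul, Real.norm_of_nonneg (sq_nonneg (g x))]
  exact mul_le_mul_of_nonneg_right (φ.norm_coe_le_norm x) (sq_nonneg _)

/-- The mean on `ℓ∞(X)` with density `g² / ‖g‖²`. -/
noncomputable def densityMean {X : Type*} [TopologicalSpace X] (g : lp (fun _ : X => ℝ) 2) :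
    (X →ᵇ ℝ) →ₗ[ℝ] ℝ where
  toFun φ := (∑' x, φ x * g x ^ 2) / ‖g‖ ^ 2
  map_add' φ ψ := by
    simp only [BoundedContinuousFunction.coe_add, Pi.add_apply, add_mul]
    rw [(summable_mul_sq_lp φ g).tsum_add (summable_mul_sq_lp ψ g), add_div]
  map_smul' c φ := by
    simp only [BoundedContinuousFunction.coe_smul, smul_eq_mul, mul_assoc, tsum_mul_left,
      RingHom.id_apply, mul_div_assoc]

lemma densityMean_apply {X : Type*} [TopologicalSpace X] (g : lp (fun _ : X => ℝ) 2)
    (φ : X →ᵇ ℝ) : densityMean g φ = (∑' x, φ x * g x ^ 2) / ‖g‖ ^ 2 :=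
  rfl

lemma abs_densityMean_sub_le {X : Type*} [TopologicalSpace X] {g u : lp (fun _ : X => ℝ) 2}
    (hg : g ≠ 0) (hu : ‖u‖ = ‖g‖) {η : ℝ} (hη : 0 < η) (h : ‖u - g‖ ^ 2 ≤ η ^ 2 * ‖g‖ ^ 2)
    (φ : X →ᵇ ℝ) : |densityMean u φ - densityMean g φ| ≤ 5 / 2 * η * ‖φ‖ := by
  have hg2 : 0 < ‖g‖ ^ 2 := by positivity
  have hbound (x : X) : |φ x * u x ^ 2 - φ x * g x ^ 2| ≤
      ‖φ‖ * (1 / (2 * η) * (u - g) x ^ 2 + η / 2 * (u + g) x ^ 2) := by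
    rw [← mul_sub, abs_mul]
    refine mul_le_mul (φ.norm_coe_le_norm x) ?_ (abs_nonneg _) (norm_nonneg _)
    have h1 : (u - g) x = u x - g x := rfl
    have h2 : (u + g) x = u x + g x := rfl
    rw [h1, h2, show u x ^ 2 - g x ^ 2 = (u x - g x) * (u x + g x) by ring]
    generalize u x - g x = a
    generalize u x + g x = b
    have key : 1 / (2 * η) * a ^ 2 + η / 2 * b ^ 2 = (a ^ 2 + η ^ 2 * b ^ 2) / (2 * η) := by
      field_simp
    rw [key, le_div_iff₀ (by positivity), abs_mul, ← sq_abs a, ← sq_abs b]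
    nlinarith [sq_nonneg (|a| - η * |b|)]
  have hsum : Summable fun x =>
      ‖φ‖ * (1 / (2 * η) * (u - g) x ^ 2 + η / 2 * (u + g) x ^ 2) :=
    (((summable_sq_lp (u - g)).mul_left _).add ((summable_sq_lp (u + g)).mul_left _)).mul_left _
  have htotal : |∑' x, (φ x * u x ^ 2 - φ x * g x ^ 2)| ≤
      ‖φ‖ * (1 / (2 * η) * ‖u - g‖ ^ 2 + η / 2 * ‖u + g‖ ^ 2) := by
    have := tsum_of_norm_bounded
      (f := fun x => φ x * u x ^ 2 - φ x * g x ^ 2) hsum.hasSum hbound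
    rwa [Real.norm_eq_abs, tsum_mul_left, ((summable_sq_lp (u - g)).mul_left _).tsum_add
      ((summable_sq_lp (u + g)).mul_left _), tsum_mul_left, tsum_mul_left,
      ← norm_sq_eq_tsum_lp, ← norm_sq_eq_tsum_lp] at this
  have hadd : ‖u + g‖ ^ 2 ≤ 4 * ‖g‖ ^ 2 := by
    have := norm_add_le u g
    rw [hu] at this
    nlinarith [norm_nonneg (u + g), norm_nonneg g]
  rw [densityMean_apply, densityMean_apply, hu, ← sub_div,
    ← (summable_mul_sq_lp φ u).tsum_sub (summable_mul_sq_lp φ g), abs_div,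
    abs_of_pos hg2, div_le_iff₀ hg2]
  refine htotal.trans ?_
  calc ‖φ‖ * (1 / (2 * η) * ‖u - g‖ ^ 2 + η / 2 * ‖u + g‖ ^ 2)
      ≤ ‖φ‖ * (1 / (2 * η) * (η ^ 2 * ‖g‖ ^ 2) + η / 2 * (4 * ‖g‖ ^ 2)) := by gcongr
    _ = 5 / 2 * η * ‖φ‖ * ‖g‖ ^ 2 := by
        field_simp
        ring

lemma densityMean_lregTranslate {Γ : Type*} [Group Γ] [TopologicalSpace Γ] [DiscreteTopology Γ]
    (s : Γ) (g : lp (fun _ : Γ => ℝ) 2) (φ : Γ →ᵇ ℝ) :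
    densityMean g (lregTranslate s φ) = densityMean (leftRegular Γ s⁻¹ g) φ := by
  rw [densityMean_apply, densityMean_apply, norm_leftRegular]
  congr 1
  rw [← (Equiv.mulLeft s).tsum_eq]
  simp [lregTranslate]

/-- The multiset form of Følner's criterion. -/
lemma nonempty_invariantMean_of_forall_inter {Γ : Type*} [Group Γ] [DecidableEq Γ]
    [TopologicalSpace Γ] [DiscreteTopology Γ] {k : ℝ} (hk : 0 < k)
    (h : ∀ (n : ℕ) (S : Fin n → Γ), 0 < n → ∃ F : Finset Γ, F.Nonempty ∧
      k * n * F.card ≤ ∑ i, ((F.image (S i • ·) ∩ F).card : ℝ)) :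
    Nonempty (InvariantMean Γ Γ) := by
  refine nonempty_invariantMean_of_approx fun T η hη => ?_
  obtain ⟨m, S, hm, hS⟩ : ∃ (m : ℕ) (S : Fin m → Γ), 0 < m ∧ ∀ t ∈ insert 1 T, ∃ i, S i = t :=
    ⟨_, fun i => (insert 1 T).equivFin.symm i, (Finset.insert_nonempty 1 T).card_pos,
      fun t ht => ⟨(insert 1 T).equivFin ⟨t, ht⟩, by simp⟩⟩
  have hm0 : (0 : ℝ) < m := by exact_mod_cast hm
  let δ : ℝ := min (1 / 2) ((2 / 5 * η) ^ 2 / (2 * m ^ 2))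
  have hδ0 : 0 < δ := by positivity
  have hδ1 : δ ≤ 1 / 2 := min_le_left _ _
  have hδ2 : 2 * m ^ 2 * δ ≤ (2 / 5 * η) ^ 2 := by
    have : δ ≤ (2 / 5 * η) ^ 2 / (2 * m ^ 2) := min_le_right _ _
    rwa [le_div_iff₀ (by positivity), mul_comm] at this
  obtain ⟨g, hg⟩ := exists_almost_norm_preserved (leftRegular Γ) norm_leftRegular hk
    (fun κ _ _ w => by
      let e' := Fintype.equivFin κ
      obtain ⟨F, hF, hsum⟩ := h _ (w ∘ e'.symm) Fintype.card_pos
      have hF0 : (0 : ℝ) < ‖finsetIndicator F‖ ^ 2 := by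
        rw [norm_finsetIndicator_sq]
        exact_mod_cast hF.card_pos
      refine ⟨finsetIndicator F, fun h0 => by simp [h0] at hF0, ?_⟩
      rw [norm_finsetIndicator_sq]
      simp only [inner_leftRegular_finsetIndicator]
      rw [← e'.symm.sum_comp]
      exact hsum) hm S (c := 1 - δ) (by linarith) (by linarith)
  have hg0 : g ≠ 0 := by
    rintro rfl
    simp at hg
  have hg2 : 0 < ‖g‖ ^ 2 := by positivity
  refine ⟨densityMean g, fun φ hφ => ?_, ?_, fun s hs φ => ?_⟩
  · exact div_nonneg (tsum_nonneg fun x => mul_nonneg (hφ x) (sq_nonneg _)) hg2.le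
  · simp [densityMean_apply, ← norm_sq_eq_tsum_lp, hg2.ne']
  · obtain ⟨i, hi⟩ := hS 1 (Finset.mem_insert_self 1 T)
    obtain ⟨j, hj⟩ := hS s (Finset.mem_insert_of_mem hs)
    have hclose := norm_sub_sq_le_of_norm_eq (fun i => leftRegular Γ (S i) g)
      (fun i => norm_leftRegular (S i) g) i j
    have hnorm : ‖leftRegular Γ s⁻¹ g - g‖ = ‖leftRegular Γ (S i) g - leftRegular Γ (S j) g‖ := by
      rw [hi, hj, ← norm_leftRegular s (leftRegular Γ s⁻¹ g - g), map_sub,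
        ← Module.End.mul_apply, ← map_mul, mul_inv_cancel]
    rw [densityMean_lregTranslate]
    have := abs_densityMean_sub_le hg0 (norm_leftRegular s⁻¹ g) (η := 2 / 5 * η) (by positivity)
      (by
        rw [hnorm]
        refine hclose.trans ?_
        nlinarith) φ
    linarith

lemma exists_inter_of_conductance_lt {Γ : Type*} [Group Γ] [DecidableEq Γ] {n : ℕ}
    (S : Fin n → Γ) (hn : 0 < n) {k : ℝ} (h : conductance n S < 1 - k) :
    ∃ F : Finset Γ, F.Nonempty ∧
      k * n * F.card ≤ ∑ i, ((F.image (S i • ·) ∩ F).card : ℝ) := by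
  have hn0 : (0 : ℝ) < n := by exact_mod_cast hn
  have : Nonempty {F : Finset Γ // F.Nonempty} := ⟨⟨{1}, Finset.singleton_nonempty 1⟩⟩
  rw [conductance, one_div_mul_eq_div, div_lt_iff₀ hn0] at h
  obtain ⟨⟨F, hF⟩, hlt⟩ := exists_lt_of_ciInf_lt h
  refine ⟨F, hF, ?_⟩
  have hF0 : (0 : ℝ) < F.card := by exact_mod_cast hF.card_pos
  rw [div_lt_iff₀ hF0] at hlt
  have hsplit (i : Fin n) : ((F.image (S i • ·) ∩ F).card : ℝ) =
      F.card - ((F.image (S i • ·) \ F).card : ℝ) := by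
    have hcard := Finset.card_inter_add_card_sdiff (F.image (S i • ·)) F
    rw [Finset.card_image_of_injective F (MulAction.injective (S i))] at hcard
    rw [← hcard]
    push_cast
    ring
  simp only [hsplit, Finset.sum_sub_distrib, Finset.sum_const, Finset.card_univ,
    Fintype.card_fin, nsmul_eq_mul]
  linarith

/-- A countable group is non-amenable iff for every `ε ∈ (0,1)` some finite multiset `S`
has conductance constant `h(Γ,S) > 1 − ε`. -/
theorem nonamenable_iff_high_conductance
    {Γ : Type*} [Group Γ] [Countable Γ] [DecidableEq Γ]
    [TopologicalSpace Γ] [DiscreteTopology Γ] :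
    IsEmpty (InvariantMean Γ Γ) ↔
      ∀ ε : ℝ, ε ∈ Set.Ioo (0 : ℝ) 1 →
        ∃ (n : ℕ) (S : Fin n → Γ), 0 < n ∧ 1 - ε < conductance n S := by
  constructor
  · intro hempty ε hε
    by_contra! h
    have hε0 := hε.1
    have := nonempty_invariantMean_of_forall_inter (k := ε / 2) (by linarith) fun n S hn =>
      exists_inter_of_conductance_lt (Γ := Γ) S hn (by linarith [h n S hn])
    exact not_isEmpty_iff.2 this hempty
  · intro h
    obtain ⟨n, S, hn, hS⟩ := h (1 / 2) (by norm_num)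
    exact isEmpty_invariantMean_of_conductance S hn (by linarith)
end

section
/- (Følner's other criterion, hard direction) Let Γ act on a nonempty set X. Suppose there exists k ∈ (0,1) such that for every finite multiset S in Γ there is a finite nonempty F ⊆ X with (1/|S|)·Σ_{s∈S}|sF ∩ F| > k·|F|. Then the action of Γ on X is amenable, i.e., there is a Γ-invariant mean on ℓ∞(X). -/
open BoundedContinuousFunction

open Filter Topology in
/-- Ultralimits of positive normalized functionals that are asymptotically invariant are
invariant means. -/
theorem nonempty_invariantMean_of_almost_invariant {Γ X : Type*} [Group Γ] [MulAction Γ X]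
    [TopologicalSpace X] [DiscreteTopology X]
    (h : ∀ (E : Finset Γ) (ε : ℝ), 0 < ε → ∃ φ : (X →ᵇ ℝ) →ₗ[ℝ] ℝ,
      (∀ f : X →ᵇ ℝ, (∀ x, 0 ≤ f x) → 0 ≤ φ f) ∧ φ 1 = 1 ∧
      ∀ γ ∈ E, ∀ f : X →ᵇ ℝ, |φ (lregTranslate γ f) - φ f| ≤ ε * ‖f‖) :
    Nonempty (InvariantMean Γ X) := by
  classical
  choose φ hpos hone hinv using fun i : Finset Γ × ℕ =>
    h i.1 (1 / ((i.2 : ℝ) + 1)) Nat.one_div_pos_of_nat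
  let U : Ultrafilter (Finset Γ × ℕ) := Ultrafilter.of atTop
  have hU : (U : Filter (Finset Γ × ℕ)) ≤ atTop := Ultrafilter.of_le _
  have hbound (f : X →ᵇ ℝ) (i) : φ i f ∈ Set.Icc (-‖f‖) ‖f‖ := by
    have h₁ := hpos i (‖f‖ • 1 - f) fun x => by
      have := (abs_le.1 (f.norm_coe_le_norm x)).2
      simpa using this
    have h₂ := hpos i (‖f‖ • 1 + f) fun x => by
      have := (abs_le.1 (f.norm_coe_le_norm x)).1
      simp only [coe_add, coe_smul, coe_one, Pi.add_apply, Pi.one_apply, smul_eq_mul, mul_one]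
      linarith
    simp only [map_sub, map_add, map_smul, hone, smul_eq_mul, mul_one] at h₁ h₂
    constructor <;> linarith
  have hlim (f : X →ᵇ ℝ) : ∃ L, Tendsto (fun i => φ i f) U (𝓝 L) := by
    obtain ⟨L, -, hL⟩ := (isCompact_Icc (a := -‖f‖) (b := ‖f‖)).ultrafilter_le_nhds'
      (U.map fun i => φ i f) (Filter.mem_map.2 (Filter.univ_mem' (hbound f)))
    exact ⟨L, hL⟩
  choose m hm using hlim
  refine ⟨⟨⟨m, fun f g => ?_⟩, fun c f => ?_⟩, fun f hf => ?_, ?_, fun γ f => ?_⟩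
  · refine tendsto_nhds_unique (hm (f + g)) ?_
    simpa using (hm f).add (hm g)
  · refine tendsto_nhds_unique (hm (c • f)) ?_
    simpa using (hm f).const_mul c
  · exact ge_of_tendsto' (hm f) fun i => hpos i f hf
  · refine tendsto_nhds_unique (hm 1) ?_
    simp [hone]
  · have hzero : Tendsto (fun i : Finset Γ × ℕ => 1 / ((i.2 : ℝ) + 1) * ‖f‖) U (𝓝 0) := by
      have := (tendsto_one_div_add_atTop_nhds_zero_nat (𝕜 := ℝ)).comp
        (tendsto_snd.comp (hU.trans prod_atTop_atTop_eq.ge))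
      simpa using this.mul_const ‖f‖
    have hmem : ∀ᶠ i : Finset Γ × ℕ in U, γ ∈ i.1 := by
      filter_upwards [hU (eventually_ge_atTop (({γ} : Finset Γ), 0))] with i hi
      exact hi.1 (Finset.mem_singleton_self γ)
    have hdiff : Tendsto (fun i => φ i (lregTranslate γ f) - φ i f) U (𝓝 0) := by
      refine squeeze_zero_norm' ?_ hzero
      filter_upwards [hmem] with i hi using hinv i γ hi f
    exact sub_eq_zero.1 (tendsto_nhds_unique ((hm _).sub (hm f)) hdiff)

/-- The average of a finite family of elements under a representation. -/
noncomputable def repAverage {Γ H : Type*} [Monoid Γ] [AddCommGroup H] [Module ℝ H]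
    (π : Γ →* Module.End ℝ H) {n : ℕ} (S : Fin n → Γ) : Module.End ℝ H :=
  (1 / (n : ℝ)) • ∑ i, π (S i)

theorem repAverage_mul {Γ H : Type*} [Monoid Γ] [AddCommGroup H] [Module ℝ H]
    (π : Γ →* Module.End ℝ H) {n m : ℕ} (S : Fin n → Γ) (T : Fin m → Γ) :
    repAverage π S * repAverage π T = repAverage π fun p : Fin (n * m) =>
      S (finProdFinEquiv.symm p).1 * T (finProdFinEquiv.symm p).2 := by
  simp only [repAverage, smul_mul_smul_comm, Finset.sum_mul_sum, ← map_mul]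
  congr 1
  · push_cast
    ring
  · rw [← Fintype.sum_prod_type']
    exact (finProdFinEquiv.symm.sum_comp fun p : Fin n × Fin m => π (S p.1 * T p.2)).symm

theorem exists_repAverage_eq_pow {Γ H : Type*} [Monoid Γ] [AddCommGroup H] [Module ℝ H]
    (π : Γ →* Module.End ℝ H) {n : ℕ} (hn : 0 < n) (S : Fin n → Γ) (j : ℕ) :
    ∃ (N : ℕ) (_ : 0 < N) (T : Fin N → Γ), repAverage π S ^ j = repAverage π T := by
  induction j with
  | zero => exact ⟨1, one_pos, fun _ => 1, by simp [repAverage]⟩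
  | succ j ih =>
    obtain ⟨N, hN, T, hT⟩ := ih
    exact ⟨N * n, Nat.mul_pos hN hn, _, by rw [pow_succ, hT, repAverage_mul]⟩

/-- If the powers of an operator do not decay uniformly, the operator almost preserves the norm
of some nonzero vector. -/
theorem exists_lt_norm_apply_of_pow {H : Type*} [NormedAddCommGroup H] [Module ℝ H]
    (P : Module.End ℝ H) {k : ℝ} (hk : 0 < k)
    (h : ∀ j : ℕ, ∃ f : H, f ≠ 0 ∧ k * ‖f‖ ≤ ‖(P ^ j) f‖) {ε : ℝ} (hε : 0 < ε) (hε1 : ε < 1) :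
    ∃ v : H, (1 - ε) * ‖v‖ < ‖P v‖ := by
  by_contra! hP
  have hpow (j : ℕ) (f : H) : ‖(P ^ j) f‖ ≤ (1 - ε) ^ j * ‖f‖ := by
    induction j with
    | zero => simp
    | succ j ih =>
      rw [pow_succ', Module.End.mul_apply, pow_succ', mul_assoc]
      exact (hP _).trans (mul_le_mul_of_nonneg_left ih (by linarith))
  obtain ⟨j, hj⟩ := exists_pow_lt_of_lt_one hk (by linarith : 1 - ε < 1)
  obtain ⟨f, hf, hkf⟩ := h j
  have := hkf.trans (hpow j f)
  exact (mul_lt_mul_of_pos_right hj (norm_pos_iff.2 hf)).not_ge this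

/-- Vectors of equal norm whose average has almost the same norm are close to each other. -/
theorem norm_sub_sq_le_of_norm_sum {H : Type*} [NormedAddCommGroup H] [InnerProductSpace ℝ H]
    {ι : Type*} [Fintype ι] (u : ι → H) {a ε : ℝ} (hu : ∀ i, ‖u i‖ = a) (hε : 0 ≤ ε)
    (h : (1 - ε) * a * Fintype.card ι ≤ ‖∑ i, u i‖) (i j : ι) :
    ‖u i - u j‖ ^ 2 ≤ 4 * Fintype.card ι * ε * a ^ 2 := by
  classical
  have ha : 0 ≤ a := hu i ▸ norm_nonneg _
  obtain rfl | hij := eq_or_ne i j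
  · rw [sub_self, norm_zero, zero_pow two_ne_zero]
    positivity
  have hcard : ((Finset.univ \ {i, j} : Finset ι).card : ℝ) = Fintype.card ι - 2 := by
    rw [Finset.card_sdiff_of_subset (Finset.subset_univ _), Nat.cast_sub
      (Finset.card_le_card (Finset.subset_univ _)), Finset.card_pair hij, Finset.card_univ, Nat.cast_two]
  have hsum : ‖∑ l, u l‖ ≤ (Fintype.card ι - 2) * a + ‖u i + u j‖ := by
    rw [← Finset.sum_sdiff (Finset.subset_univ {i, j}), Finset.sum_pair hij, ← hcard]
    refine (norm_add_le _ _).trans (add_le_add_left ((norm_sum_le _ _).trans ?_) _)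
    simp [hu]
  have hadd : 2 * a - Fintype.card ι * ε * a ≤ ‖u i + u j‖ := by linarith
  have hpar := parallelogram_law_with_norm ℝ (u i) (u j)
  rw [hu, hu] at hpar
  nlinarith [mul_nonneg ha (sub_nonneg.2 hadd),
    mul_nonneg (norm_nonneg (u i + u j)) (sub_nonneg.2 hadd)]

/-- Translation of `ℓ²` functions along a group action. -/
noncomputable def l2Translate (Γ X : Type*) [Group Γ] [MulAction Γ X] :
    Γ →* Module.End ℝ (lp (fun _ : X => ℝ) 2) where
  toFun γ :=
    { toFun v := ⟨fun x => v (γ⁻¹ • x), memℓp_gen <|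
        ((lp.memℓp v).summable (by norm_num)).comp_injective (MulAction.injective γ⁻¹)⟩
      map_add' _ _ := rfl
      map_smul' _ _ := rfl }
  map_one' := by
    ext v x
    change v ((1 : Γ)⁻¹ • x) = v x
    simp
  map_mul' γ δ := by
    ext v x
    change v ((γ * δ)⁻¹ • x) = v (δ⁻¹ • γ⁻¹ • x)
    rw [mul_inv_rev, mul_smul]

theorem l2Translate_apply {Γ X : Type*} [Group Γ] [MulAction Γ X] (γ : Γ)
    (v : lp (fun _ : X => ℝ) 2) (x : X) : l2Translate Γ X γ v x = v (γ⁻¹ • x) :=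
  rfl

theorem norm_l2Translate {Γ X : Type*} [Group Γ] [MulAction Γ X] (γ : Γ)
    (v : lp (fun _ : X => ℝ) 2) : ‖l2Translate Γ X γ v‖ = ‖v‖ := by
  rw [lp.norm_eq_tsum_rpow (by norm_num), lp.norm_eq_tsum_rpow (by norm_num)]
  congr 1
  exact (MulAction.toPerm γ⁻¹).tsum_eq fun x => ‖v x‖ ^ (2 : ENNReal).toReal

/-- The indicator function of a finite set as an element of `ℓ²`. -/
noncomputable def l2Indicator {X : Type*} (F : Finset X) : lp (fun _ : X => ℝ) 2 :=
  ⟨(F : Set X).indicator 1, memℓp_gen <| summable_of_hasFiniteSupport <|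
    F.finite_toSet.subset fun x hx => by
      by_contra hxF
      exact hx (by simp [Set.indicator_of_notMem hxF])⟩

theorem inner_l2Indicator {X : Type*} [DecidableEq X] (F G : Finset X) :
    inner ℝ (l2Indicator F) (l2Indicator G) = ((F ∩ G).card : ℝ) := by
  have hterm (x : X) : inner ℝ (l2Indicator F x) (l2Indicator G x) =
      ((F ∩ G : Finset X) : Set X).indicator (1 : X → ℝ) x := by
    change inner ℝ ((F : Set X).indicator (1 : X → ℝ) x) ((G : Set X).indicator (1 : X → ℝ) x) = _
    by_cases hF : x ∈ F <;> by_cases hG : x ∈ G <;> simp [hF, hG]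
  rw [lp.inner_eq_tsum, tsum_congr hterm, ← sum_eq_tsum_indicator]
  simp

theorem norm_l2Indicator_sq {X : Type*} (F : Finset X) :
    ‖l2Indicator F‖ ^ 2 = (F.card : ℝ) := by
  classical
  rw [← real_inner_self_eq_norm_sq, inner_l2Indicator, Finset.inter_self]

theorem l2Translate_l2Indicator {Γ X : Type*} [Group Γ] [MulAction Γ X] [DecidableEq X] (γ : Γ)
    (F : Finset X) : l2Translate Γ X γ (l2Indicator F) = l2Indicator (F.image (γ • ·)) := by
  ext x
  change (F : Set X).indicator (1 : X → ℝ) (γ⁻¹ • x) =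
    ((F.image (γ • ·) : Finset X) : Set X).indicator (1 : X → ℝ) x
  have : γ⁻¹ • x ∈ F ↔ x ∈ F.image (γ • ·) := by
    simp [Finset.mem_image, ← eq_inv_smul_iff]
  by_cases hx : γ⁻¹ • x ∈ F
  · simp [hx, -Finset.coe_image, this.1 hx]
  · simp [hx, -Finset.coe_image, mt this.2 hx]

theorem l2_tsum_mul_bound {X : Type*} {f : X → ℝ} {C : ℝ} (hf : ∀ x, |f x| ≤ C)
    (a b : lp (fun _ : X => ℝ) 2) :
    Summable (fun x => f x * (a x * b x)) ∧ |∑' x, f x * (a x * b x)| ≤ C * (‖a‖ * ‖b‖) := by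
  obtain ⟨hs, hle⟩ := lp.tsum_mul_le_mul_norm (p := 2) (q := 2)
    (by rw [Real.holderConjugate_iff]; norm_num) a b
  have hterm (x : X) : ‖f x * (a x * b x)‖ ≤ C * (‖a x‖ * ‖b x‖) := by
    rw [norm_mul, norm_mul]
    exact mul_le_mul_of_nonneg_right (hf x) (by positivity)
  refine ⟨.of_norm_bounded (hs.mul_left C) hterm, ?_⟩
  obtain hX | ⟨⟨x⟩⟩ := isEmpty_or_nonempty X
  · have ha : a = 0 := by ext x; exact hX.elim x
    simp [ha]
  have hC : 0 ≤ C := (abs_nonneg _).trans (hf x)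
  exact (tsum_of_norm_bounded (hs.mul_left C).hasSum hterm).trans
    (by rw [tsum_mul_left]; exact mul_le_mul_of_nonneg_left hle hC)

/-- The functional on bounded functions given by integration against the density `v²`. -/
noncomputable def l2Density {X : Type*} [TopologicalSpace X] (v : lp (fun _ : X => ℝ) 2) :
    (X →ᵇ ℝ) →ₗ[ℝ] ℝ where
  toFun f := ∑' x, f x * (v x * v x)
  map_add' f g := by
    rw [← ((l2_tsum_mul_bound f.norm_coe_le_norm v v).1).tsum_add
      (l2_tsum_mul_bound g.norm_coe_le_norm v v).1]
    simp [add_mul]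
  map_smul' c f := by
    simp [mul_assoc, tsum_mul_left]

theorem l2Density_apply {X : Type*} [TopologicalSpace X] (v : lp (fun _ : X => ℝ) 2)
    (f : X →ᵇ ℝ) : l2Density v f = ∑' x, f x * (v x * v x) :=
  rfl

theorem l2Density_one {X : Type*} [TopologicalSpace X] (v : lp (fun _ : X => ℝ) 2) :
    l2Density v 1 = ‖v‖ ^ 2 := by
  rw [l2Density_apply, ← real_inner_self_eq_norm_sq, lp.inner_eq_tsum]
  simp [sq]

theorem abs_l2Density_lregTranslate_sub_le {Γ X : Type*} [Group Γ] [MulAction Γ X]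
    [TopologicalSpace X] [DiscreteTopology X] (v : lp (fun _ : X => ℝ) 2) (γ : Γ) (f : X →ᵇ ℝ) :
    |l2Density v (lregTranslate γ f) - l2Density v f| ≤
      ‖f‖ * (‖l2Translate Γ X γ v - v‖ * (2 * ‖v‖)) := by
  set w := l2Translate Γ X γ v with hw
  have hf (x : X) : |f (γ⁻¹ • x)| ≤ ‖f‖ := f.norm_coe_le_norm _
  have hshift : l2Density v f = ∑' x, f (γ⁻¹ • x) * (w x * w x) :=
    ((MulAction.toPerm γ⁻¹).tsum_eq fun x => f x * (v x * v x)).symm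
  have hdiff : l2Density v f - l2Density v (lregTranslate γ f) =
      ∑' x, f (γ⁻¹ • x) * ((w - v) x * (w + v) x) := by
    rw [hshift]
    refine ((l2_tsum_mul_bound hf w w).1.tsum_sub (l2_tsum_mul_bound hf v v).1).symm.trans
      (tsum_congr fun x => ?_)
    simp only [lp.coeFn_sub, lp.coeFn_add, Pi.sub_apply, Pi.add_apply]
    ring
  rw [abs_sub_comm, hdiff]
  refine (l2_tsum_mul_bound hf _ _).2.trans ?_
  gcongr
  refine (norm_add_le _ _).trans_eq ?_
  rw [hw, norm_l2Translate]
  ring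

/-- A uniform Følner-type bound keeps the powers of averaging operators on `ℓ²` from decaying. -/
theorem exists_le_norm_repAverage_l2Translate {Γ X : Type*} [Group Γ] [MulAction Γ X]
    [DecidableEq X] {k : ℝ} {n : ℕ} (S : Fin n → Γ)
    (h : ∃ F : Finset X, F.Nonempty ∧
      k * F.card < (1 / (n : ℝ)) * ∑ i, ((F.image (S i • ·) ∩ F).card : ℝ)) :
    ∃ f : lp (fun _ : X => ℝ) 2, f ≠ 0 ∧ k * ‖f‖ ≤ ‖repAverage (l2Translate Γ X) S f‖ := by
  obtain ⟨F, hF, hlt⟩ := h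
  have hpos : 0 < ‖l2Indicator F‖ := by
    have : 0 < ‖l2Indicator F‖ ^ 2 := by
      rw [norm_l2Indicator_sq]
      exact_mod_cast hF.card_pos
    exact (norm_nonneg _).lt_of_ne' fun h0 => by simp [h0] at this
  refine ⟨l2Indicator F, norm_pos_iff.1 hpos, ?_⟩
  have hinner : inner ℝ (repAverage (l2Translate Γ X) S (l2Indicator F)) (l2Indicator F) =
      (1 / (n : ℝ)) * ∑ i, ((F.image (S i • ·) ∩ F).card : ℝ) := by
    simp only [repAverage, LinearMap.smul_apply, LinearMap.sum_apply, real_inner_smul_left,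
      sum_inner, l2Translate_l2Indicator, inner_l2Indicator]
  have hcs := real_inner_le_norm (repAverage (l2Translate Γ X) S (l2Indicator F)) (l2Indicator F)
  rw [hinner] at hcs
  rw [← norm_l2Indicator_sq] at hlt
  refine le_of_mul_le_mul_right ?_ hpos
  nlinarith

/-- Averaging operators whose powers do not decay have almost invariant vectors. -/
theorem exists_almost_invariant_of_repAverage_pow {Γ H : Type*} [Monoid Γ]
    [NormedAddCommGroup H] [InnerProductSpace ℝ H] (π : Γ →* Module.End ℝ H)
    (hπ : ∀ γ v, ‖π γ v‖ = ‖v‖) {k : ℝ} (hk : 0 < k)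
    (h : ∀ n : ℕ, 0 < n → ∀ S : Fin n → Γ, ∃ f : H, f ≠ 0 ∧ k * ‖f‖ ≤ ‖repAverage π S f‖)
    (E : Finset Γ) {δ : ℝ} (hδ : 0 < δ) :
    ∃ v : H, v ≠ 0 ∧ ∀ γ ∈ E, ‖π γ v - v‖ ≤ δ * ‖v‖ := by
  classical
  set E' : Finset Γ := insert 1 E
  set n := E'.card
  have hn0 : 0 < n := Finset.card_pos.2 (Finset.insert_nonempty _ _)
  have hn0' : (0 : ℝ) < n := by exact_mod_cast hn0
  let S : Fin n → Γ := fun i => E'.equivFin.symm i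
  have hS (γ : Γ) (hγ : γ ∈ E') : ∃ i, S i = γ := ⟨E'.equivFin ⟨γ, hγ⟩, by simp [S]⟩
  set ε : ℝ := min (1 / 2) (δ ^ 2 / (4 * n)) with hεdef
  have hε : 0 < ε := by positivity
  have hε1 : ε < 1 := (min_le_left _ _).trans_lt (by norm_num)
  obtain ⟨v, hv⟩ := exists_lt_norm_apply_of_pow (repAverage π S) hk (fun j => by
    obtain ⟨N, hN, T, hT⟩ := exists_repAverage_eq_pow π hn0 S j
    rw [hT]
    exact h N hN T) hε hε1
  refine ⟨v, ?_, fun γ hγ => ?_⟩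
  · rintro rfl
    simp at hv
  obtain ⟨i, hi⟩ := hS γ (Finset.mem_insert_of_mem hγ)
  obtain ⟨j, hj⟩ := hS 1 (Finset.mem_insert_self _ _)
  have hsum : (1 - ε) * ‖v‖ * Fintype.card (Fin n) ≤ ‖∑ i, π (S i) v‖ := by
    rw [repAverage, LinearMap.smul_apply, LinearMap.sum_apply, norm_smul,
      Real.norm_of_nonneg (by positivity), one_div, inv_mul_eq_div, lt_div_iff₀ hn0'] at hv
    simpa using hv.le
  have hclose := norm_sub_sq_le_of_norm_sum (fun i => π (S i) v) (fun i => hπ _ _) hε.le hsum i j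
  simp only [hi, hj, map_one, Module.End.one_apply, Fintype.card_fin] at hclose
  refine le_of_sq_le_sq (hclose.trans ?_) (by positivity)
  rw [mul_pow]
  gcongr
  have := min_le_right (1 / 2) (δ ^ 2 / (4 * (n : ℝ)))
  rw [← hεdef, le_div_iff₀ (by positivity)] at this
  linarith

/-- (Følner's other criterion, hard direction.) If there is `k ∈ (0,1)` such that every
finite multiset `S` in `Γ` admits a finite nonempty `F ⊆ X` with
`(1/|S|)·Σ_{s∈S}|sF ∩ F| > k·|F|`, then the action of `Γ` on `X` is amenable. -/
theorem folner_other_criterion_hard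
    {Γ X : Type*} [Group Γ] [Countable Γ] [MulAction Γ X] [Nonempty X] [DecidableEq X]
    [TopologicalSpace X] [DiscreteTopology X]
    (hyp : ∃ k : ℝ, k ∈ Set.Ioo (0 : ℝ) 1 ∧
      ∀ (n : ℕ), 0 < n → ∀ S : Fin n → Γ,
        ∃ F : Finset X, F.Nonempty ∧
          k * F.card < (1 / (n : ℝ)) * ∑ i, ((F.image (S i • ·) ∩ F).card : ℝ)) :
    Nonempty (InvariantMean Γ X) := by
  obtain ⟨k, ⟨hk, -⟩, hF⟩ := hyp
  refine nonempty_invariantMean_of_almost_invariant fun E ε hε => ?_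
  obtain ⟨v, hv, hinv⟩ := exists_almost_invariant_of_repAverage_pow (l2Translate Γ X)
    norm_l2Translate hk (fun n hn S => exists_le_norm_repAverage_l2Translate S (hF n hn S)) E
    (half_pos hε)
  have hv' : 0 < ‖v‖ := norm_pos_iff.2 hv
  refine ⟨(‖v‖ ^ 2)⁻¹ • l2Density v, fun f hf => ?_, ?_, fun γ hγ f => ?_⟩
  · exact mul_nonneg (by positivity)
      (tsum_nonneg fun x => mul_nonneg (hf x) (mul_self_nonneg _))
  · rw [LinearMap.smul_apply, l2Density_one, smul_eq_mul, inv_mul_cancel₀ (by positivity)]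
  · rw [LinearMap.smul_apply, LinearMap.smul_apply, ← smul_sub, smul_eq_mul, abs_mul,
      abs_of_pos (by positivity), inv_mul_le_iff₀ (by positivity)]
    calc _ ≤ ‖f‖ * (‖l2Translate Γ X γ v - v‖ * (2 * ‖v‖)) :=
          abs_l2Density_lregTranslate_sub_le v γ f
      _ ≤ ‖f‖ * (ε / 2 * ‖v‖ * (2 * ‖v‖)) := by
          gcongr
          exact hinv γ hγ
      _ = ‖v‖ ^ 2 * (ε * ‖f‖) := by ring
end
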